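/- arXiv:2305.03492 — 3 statements merged into one kernel-verified Lean document; each statement's English description precedes it below -/
import Mathlib

section
/- Let n ≥ 2 be an integer and let p > 1 be a real number. Let H be a symmetric n×n real matrix, let e ∈ ℝⁿ be a unit vector, and set a = ⟨He, e⟩ and T = tr(H) + (p−2)a. Then ‖H‖_F² + (p²−2p+2)·a² ≥ T²/n + (n/(n−1))·(T/n − (p−1)a)² + 2‖He‖². -/
open Matrix in
/-- If `v = H e` with `H` symmetric and `e` a unit vector, then the compression of `H` to the
orthogonal complement of `e` is at nonnegative distance from every multiple `c` of the identity. -/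
theorem compression_sub_smul_nonneg {ι : Type*} [Fintype ι] (H : Matrix ι ι ℝ)
    (hH : H.IsSymm) (e : ι → ℝ) (he : ∑ i, e i ^ 2 = 1) (c : ℝ) :
    0 ≤ (∑ i, ∑ j, H i j ^ 2) - 2 * ∑ i, (H *ᵥ e) i ^ 2 + (∑ i, (H *ᵥ e) i * e i) ^ 2
      - 2 * c * (H.trace - ∑ i, (H *ᵥ e) i * e i) + c ^ 2 * (Fintype.card ι - 1) := by
  classical
  obtain ⟨v, hv⟩ : ∃ v, v = H *ᵥ e := ⟨_, rfl⟩
  rw [← hv]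
  obtain ⟨a, ha⟩ : ∃ a, a = ∑ i, v i * e i := ⟨_, rfl⟩
  obtain ⟨V, hV⟩ : ∃ V, V = ∑ i, v i ^ 2 := ⟨_, rfl⟩
  have hHe (i : ι) : ∑ j, H i j * e j = v i := by rw [hv]; rfl
  have hHv : ∑ i, e i * (H *ᵥ v) i = V := by
    change e ⬝ᵥ H *ᵥ v = V
    rw [dotProduct_mulVec, ← mulVec_transpose, hH.eq, ← hv, hV]
    simp only [dotProduct, sq]
  have row (i : ι) :
      ∑ j, (H i j - v i * e j - e i * v j + (a + c) * (e i * e j)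
          - c * (if i = j then 1 else 0)) ^ 2 =
        (∑ j, H i j ^ 2) - v i ^ 2 + (V - (a + c) ^ 2) * e i ^ 2 + c ^ 2
          + (2 * a + 4 * c) * (v i * e i)
          - 2 * (e i * (H *ᵥ v) i) - 2 * c * H i i := by
    have expand (j : ι) :
        (H i j - v i * e j - e i * v j + (a + c) * (e i * e j)
          - c * (if i = j then 1 else 0)) ^ 2 =
        H i j ^ 2 + (v i - (a + c) * e i) ^ 2 * e j ^ 2 + e i ^ 2 * v j ^ 2
          - 2 * (v i - (a + c) * e i) * (H i j * e j) - 2 * e i * (H i j * v j)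
          + 2 * (v i - (a + c) * e i) * e i * (v j * e j)
          + (if i = j then c ^ 2 - 2 * c *
              (H i j - v i * e j - e i * v j + (a + c) * (e i * e j)) else 0) := by
      split_ifs <;> ring
    simp only [expand, Finset.sum_add_distrib, Finset.sum_sub_distrib, ← Finset.mul_sum,
      Finset.sum_ite_eq, Finset.mem_univ, if_true, he, hHe, ← ha, ← hV]
    change _ - 2 * e i * (H *ᵥ v) i + _ + _ = _
    ring
  have total : 0 ≤ ∑ i, ∑ j, (H i j - v i * e j - e i * v j + (a + c) * (e i * e j)
      - c * (if i = j then 1 else 0)) ^ 2 :=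
    Finset.sum_nonneg fun i _ => Finset.sum_nonneg fun j _ => sq_nonneg _
  simp only [row, Finset.sum_add_distrib, Finset.sum_sub_distrib, ← Finset.mul_sum, he, hHv,
    ← ha, ← hV, Finset.sum_const, Finset.card_univ, nsmul_eq_mul] at total
  rw [← ha, ← hV]
  simp only [trace, diag_apply]
  linarith

/-- The algebraic (pointwise, fixed-frame) form of the paper's key new
Hessian inequality (3.9): for `n ≥ 2`, `p > 1`, a symmetric `n × n` real matrix `H`, a unit
vector `e`, with `a = ⟨He, e⟩` and `T = tr H + (p - 2) a`, one has
`‖H‖_F² + (p² - 2p + 2) a² ≥ T²/n + (n/(n-1)) (T/n - (p-1) a)² + 2 ‖He‖²`. -/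
theorem stmt_0 (n : ℕ) (hn : 2 ≤ n) (p : ℝ) (hp : 1 < p)
    (H : Matrix (Fin n) (Fin n) ℝ) (hH : H.IsSymm)
    (e : Fin n → ℝ) (he : ∑ i, e i ^ 2 = 1)
    (a T : ℝ)
    (ha : a = ∑ i, H.mulVec e i * e i)
    (hT : T = Matrix.trace H + (p - 2) * a) :
    (∑ i, ∑ j, H i j ^ 2) + (p ^ 2 - 2 * p + 2) * a ^ 2 ≥
      T ^ 2 / n + ((n : ℝ) / ((n : ℝ) - 1)) * (T / n - (p - 1) * a) ^ 2
        + 2 * ∑ i, H.mulVec e i ^ 2 := by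
  have hn' : (2 : ℝ) ≤ n := by exact_mod_cast hn
  have hn0 : (n : ℝ) ≠ 0 := by positivity
  have hn1 : (n : ℝ) - 1 ≠ 0 := by linarith
  have key := compression_sub_smul_nonneg H hH e he ((H.trace - a) / ((n : ℝ) - 1))
  rw [← ha, Fintype.card_fin] at key
  have hc : -2 * ((H.trace - a) / ((n : ℝ) - 1)) * (H.trace - a)
      + ((H.trace - a) / ((n : ℝ) - 1)) ^ 2 * (n - 1) = -((H.trace - a) ^ 2 / (n - 1)) := by
    field_simp
    ring
  have hsplit : T ^ 2 / n + ((n : ℝ) / ((n : ℝ) - 1)) * (T / n - (p - 1) * a) ^ 2 =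
      (H.trace - a) ^ 2 / (n - 1) + ((p - 1) * a) ^ 2 := by
    rw [hT]
    field_simp
    ring
  rw [hsplit]
  linarith
end

section
/- Let n ≥ 2 be an integer and let p > 1 be a real number. Let H be a symmetric n×n real matrix, let e ∈ ℝⁿ be a unit vector, and set a = ⟨He, e⟩ and T = tr(H) + (p−2)a. Then ‖H‖_F² + p(p−2)·a² ≥ T²/n + (n/(n−1))·(T/n − (p−1)a)². -/
/-- Expansion of `‖H - s • 1 - c • e eᵀ‖_F²` for a unit vector `e`. -/
theorem Matrix.sum_sq_sub_smul_one_sub_rankOne {ι : Type*} [Fintype ι] [DecidableEq ι]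
    (H : Matrix ι ι ℝ) (e : ι → ℝ) (he : ∑ i, e i ^ 2 = 1) (s c : ℝ) :
    ∑ i, ∑ j, (H i j - s * (if i = j then 1 else 0) - c * (e i * e j)) ^ 2 =
      (∑ i, ∑ j, H i j ^ 2) + s ^ 2 * Fintype.card ι + c ^ 2 - 2 * s * H.trace
        - 2 * c * (∑ i, H.mulVec e i * e i) + 2 * s * c := by
  have hsum : ∑ i, ∑ j, (e i * e j) ^ 2 = 1 := by
    simp_rw [mul_pow, ← Finset.mul_sum, he, mul_one]
    exact he
  have hquad : ∑ i, H.mulVec e i * e i = ∑ i, ∑ j, H i j * (e i * e j) := by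
    refine Finset.sum_congr rfl fun i _ => ?_
    rw [Matrix.mulVec, dotProduct, Finset.sum_mul]
    exact Finset.sum_congr rfl fun j _ => by ring
  have hone : ∑ i : ι, ∑ j : ι, (if i = j then (1 : ℝ) else 0) = Fintype.card ι := by simp
  have htrace : ∑ i, ∑ j, (if i = j then H i j else 0) = H.trace := by simp [Matrix.trace]
  have hdiag : ∑ i, ∑ j, (if i = j then e i * e j else 0) = 1 := by
    simpa [← sq] using he
  have hentry : ∀ i j, (H i j - s * (if i = j then 1 else 0) - c * (e i * e j)) ^ 2 =
      H i j ^ 2 + s ^ 2 * (if i = j then 1 else 0) + c ^ 2 * (e i * e j) ^ 2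
        - 2 * s * (if i = j then H i j else 0) - 2 * c * (H i j * (e i * e j))
        + 2 * s * c * (if i = j then e i * e j else 0) := by
    intro i j
    split_ifs <;> ring
  simp_rw [hentry, Finset.sum_add_distrib, Finset.sum_sub_distrib, Finset.sum_add_distrib,
    ← Finset.mul_sum, hone, hsum, htrace, hdiag, hquad]
  ring

/-- Cauchy–Schwarz for the Frobenius norm, with the component along `e eᵀ` split off. -/
theorem Matrix.sq_add_sq_div_le_sum_sq {n : ℕ} (hn : 2 ≤ n)
    (H : Matrix (Fin n) (Fin n) ℝ) (e : Fin n → ℝ) (he : ∑ i, e i ^ 2 = 1) :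
    (∑ i, H.mulVec e i * e i) ^ 2 +
      (H.trace - ∑ i, H.mulVec e i * e i) ^ 2 / ((n : ℝ) - 1) ≤ ∑ i, ∑ j, H i j ^ 2 := by
  set a := ∑ i, H.mulVec e i * e i with ha
  have hn' : (0 : ℝ) < n - 1 := by
    have : (2 : ℝ) ≤ n := by exact_mod_cast hn
    linarith
  obtain ⟨s, hs⟩ : ∃ s, H.trace - a = s * ((n : ℝ) - 1) :=
    ⟨(H.trace - a) / (n - 1), by field_simp⟩
  have hexp := H.sum_sq_sub_smul_one_sub_rankOne e he s (a - s)
  have hnonneg : 0 ≤ ∑ i, ∑ j,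
      (H i j - s * (if i = j then 1 else 0) - (a - s) * (e i * e j)) ^ 2 := by positivity
  rw [hexp, ← ha, Fintype.card_fin, eq_add_of_sub_eq hs] at hnonneg
  have hdiv : (H.trace - a) ^ 2 / ((n : ℝ) - 1) = s ^ 2 * (n - 1) := by
    rw [hs]
    field_simp
  rw [hdiv]
  linarith

/-- The algebraic (pointwise, fixed-frame) form of Valtorta's refined
Cauchy–Schwarz inequality for the p-Laplacian: for `n ≥ 2`, `p > 1`, a symmetric `n × n`
real matrix `H`, a unit vector `e`, with `a = ⟨He, e⟩` and `T = tr H + (p - 2) a`, one has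
`‖H‖_F² + p (p - 2) a² ≥ T²/n + (n/(n-1)) (T/n - (p-1) a)²`. -/
theorem stmt_2 (n : ℕ) (hn : 2 ≤ n) (p : ℝ) (hp : 1 < p)
    (H : Matrix (Fin n) (Fin n) ℝ) (hH : H.IsSymm)
    (e : Fin n → ℝ) (he : ∑ i, e i ^ 2 = 1)
    (a T : ℝ)
    (ha : a = ∑ i, H.mulVec e i * e i)
    (hT : T = Matrix.trace H + (p - 2) * a) :
    (∑ i, ∑ j, H i j ^ 2) + p * (p - 2) * a ^ 2 ≥
      T ^ 2 / n + ((n : ℝ) / ((n : ℝ) - 1)) * (T / n - (p - 1) * a) ^ 2 := by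
  have hmain := H.sq_add_sq_div_le_sum_sq hn e he
  rw [← ha] at hmain
  have hn' : (2 : ℝ) ≤ n := by exact_mod_cast hn
  have hn0 : (n : ℝ) ≠ 0 := by linarith
  have hn1 : (n : ℝ) - 1 ≠ 0 := by linarith
  have hrhs : T ^ 2 / n + ((n : ℝ) / ((n : ℝ) - 1)) * (T / n - (p - 1) * a) ^ 2 =
      (H.trace - a) ^ 2 / ((n : ℝ) - 1) + ((p - 1) * a) ^ 2 := by
    rw [hT]
    field_simp
    ring
  rw [hrhs]
  linarith
end

section
/- Let n ≥ 1 be an integer, let p be a real number with 1 < p < 2, and let t be a real number with 0 ≤ t ≤ 1. Then for every symmetric n×n real matrix H and every unit vector e ∈ ℝⁿ: (p−2)²·t²·⟨He,e⟩² + 2(p−2)·t·‖He‖² + ‖H‖_F² ≥ (p−1)²·‖H‖_F². -/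
open Finset in
/-- For a symmetric matrix `H` and a unit vector `e`, compressing `H` to the orthogonal complement
of `e` yields a matrix with squared Frobenius norm `‖H‖_F² - 2 ‖He‖² + ⟨He, e⟩²`. -/
theorem two_mul_sum_mulVec_sq_le {ι : Type*} [Fintype ι] {H : Matrix ι ι ℝ} (hH : H.IsSymm)
    {e : ι → ℝ} (he : ∑ i, e i ^ 2 = 1) :
    2 * ∑ i, H.mulVec e i ^ 2 ≤
      ∑ i, ∑ j, H i j ^ 2 + (∑ i, H.mulVec e i * e i) ^ 2 := by
  have hv : ∀ i, ∑ j, H i j * e j = H.mulVec e i := fun i => rfl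
  set v := H.mulVec e
  set a := ∑ i, v i * e i with ha
  set b := ∑ i, v i ^ 2 with hb
  have hsymm : ∑ i, e i * ∑ j, H i j * v j = b := by
    simp_rw [mul_sum]
    rw [sum_comm, hb]
    refine sum_congr rfl fun j _ => ?_
    rw [sq]
    nth_rewrite 2 [← hv j]
    rw [sum_mul]
    refine sum_congr rfl fun i _ => ?_
    rw [hH.apply j i]
    ring
  have hrow : ∀ i, ∑ j, (H i j - v i * e j - e i * v j + a * (e i * e j)) ^ 2 =
      ∑ j, H i j ^ 2 - v i ^ 2 + (b - a ^ 2) * e i ^ 2 - 2 * (e i * ∑ j, H i j * v j)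
        + 2 * a * (v i * e i) := by
    intro i
    calc _ = ∑ j, (H i j ^ 2 + (v i - a * e i) ^ 2 * e j ^ 2 + e i ^ 2 * v j ^ 2
          - 2 * (v i - a * e i) * (H i j * e j) - 2 * e i * (H i j * v j)
          + 2 * (v i - a * e i) * e i * (v j * e j)) :=
          sum_congr rfl fun j _ => by ring
      _ = _ := by
          simp only [sum_add_distrib, sum_sub_distrib, ← mul_sum, he, hv, ← ha, ← hb]
          ring
  have hnonneg : 0 ≤ ∑ i, ∑ j, (H i j - v i * e j - e i * v j + a * (e i * e j)) ^ 2 := by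
    positivity
  simp only [hrow, sum_add_distrib, sum_sub_distrib, ← mul_sum, he, hsymm, ← ha, ← hb] at hnonneg
  linarith


/-- The pointwise algebraic inequality underlying the singular case
`1 < p < 2` of the paper's regularity lemma: for `n ≥ 1`, `1 < p < 2`, `0 ≤ t ≤ 1`,
every symmetric `n × n` real matrix `H` and every unit vector `e`,
`(p-2)² t² ⟨He,e⟩² + 2 (p-2) t ‖He‖² + ‖H‖_F² ≥ (p-1)² ‖H‖_F²`. -/
theorem stmt_7 (n : ℕ) (hn : 1 ≤ n) (p : ℝ) (hp1 : 1 < p) (hp2 : p < 2)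
    (t : ℝ) (ht0 : 0 ≤ t) (ht1 : t ≤ 1)
    (H : Matrix (Fin n) (Fin n) ℝ) (hH : H.IsSymm)
    (e : Fin n → ℝ) (he : ∑ i, e i ^ 2 = 1) :
    (p - 2) ^ 2 * t ^ 2 * (∑ i, H.mulVec e i * e i) ^ 2
      + 2 * (p - 2) * t * (∑ i, H.mulVec e i ^ 2)
      + ∑ i, ∑ j, H i j ^ 2
    ≥ (p - 1) ^ 2 * ∑ i, ∑ j, H i j ^ 2 := by
  have hcomp := two_mul_sum_mulVec_sq_le hH he
  have hcs := Finset.sum_mul_sq_le_sq_mul_sq Finset.univ (H.mulVec e) e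
  rw [he, mul_one] at hcs
  set a := (∑ i, H.mulVec e i * e i) ^ 2
  set b := ∑ i, H.mulVec e i ^ 2
  set f := ∑ i, ∑ j, H i j ^ 2
  have hf : 0 ≤ f := by positivity
  obtain ⟨s, hs⟩ : ∃ s, s = (2 - p) * t := ⟨_, rfl⟩
  have hs0 : 0 ≤ s := hs ▸ mul_nonneg (by linarith) ht0
  have hs1 : s ≤ 2 - p := hs ▸ mul_le_of_le_one_right (by linarith) ht1
  have hp : (p - 1) ^ 2 * f ≤ (1 - s) ^ 2 * f :=
    mul_le_mul_of_nonneg_right (pow_le_pow_left₀ (by linarith) (by linarith) 2) hf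
  have hlin : 0 ≤ s * a - 2 * b + (2 - s) * f := by
    nlinarith [mul_nonneg (by linarith : 0 ≤ 1 - s) (by linarith : 0 ≤ f - b)]
  have hmul := mul_nonneg hs0 hlin
  have hlhs : (p - 2) ^ 2 * t ^ 2 * a + 2 * (p - 2) * t * b + f = s ^ 2 * a - 2 * s * b + f := by
    rw [hs]
    ring
  rw [hlhs]
  linarith
end
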